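/- Suppose f(u) = a for all u, where a ≠ 0 is constant, g(u) = ±u + b, and the spherical curvature κ is a constant κ₀ ≠ 0. Then ΔG = ((1 + κ₀²)/a²) G on I × J; in particular M² has (non-proper) 1-type Gauss map of the first kind with constant eigenvalue λ = (1 + κ₀²)/a². -/

import Mathlib

open Matrix

noncomputable section

/-- The embedding of `ℝ³ = span{e₁,e₂,e₃}` into `ℝ⁴`. -/
def emb (p : Fin 3 → ℝ) : Fin 4 → ℝ := ![p 0, p 1, p 2, 0]

/-- The fourth standard basis vector `e₄` of `ℝ⁴`. -/
def e4 : Fin 4 → ℝ := ![0, 0, 0, 1]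

/-- Model of the bivector `a ∧ b ∈ Λ²ℝ⁴` as the antisymmetric matrix `aᵢbⱼ − aⱼbᵢ`. -/
def wedge (a b : Fin 4 → ℝ) : Fin 4 → Fin 4 → ℝ := fun i j => a i * b j - a j * b i

/-- The tangent `t = r'` of the spherical curve `r`. -/
def sphT (r : ℝ → Fin 3 → ℝ) : ℝ → Fin 3 → ℝ := deriv r

/-- The normal `n = r × t` of the spherical curve `r`. -/
def sphN (r : ℝ → Fin 3 → ℝ) (v : ℝ) : Fin 3 → ℝ := crossProduct (r v) (deriv r v)

/-- The spherical curvature `κ = ⟨t', n⟩` of the spherical curve `r`. -/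
def sphCurv (r : ℝ → Fin 3 → ℝ) (v : ℝ) : ℝ := deriv (deriv r) v ⬝ᵥ sphN r v

/-- The curvature `κ_α = f′g″ − g′f″` of the meridian curve `α = (f, g)`. -/
def merCurv (f g : ℝ → ℝ) (u : ℝ) : ℝ :=
  deriv f u * deriv (deriv g) u - deriv g u * deriv (deriv f) u

/-- The parametrization `z(u,v) = f(u) r(v) + g(u) e₄` of the meridian surface `M²`. -/
def mz (f g : ℝ → ℝ) (r : ℝ → Fin 3 → ℝ) (u v : ℝ) : Fin 4 → ℝ :=
  f u • emb (r v) + g u • e4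

/-- The tangent frame vector `x = ∂z/∂u = f′ r + g′ e₄`. -/
def mx (f g : ℝ → ℝ) (r : ℝ → Fin 3 → ℝ) (u v : ℝ) : Fin 4 → ℝ :=
  deriv f u • emb (r v) + deriv g u • e4

/-- The tangent frame vector `y = (1/f) ∂z/∂v = t`. -/
def my (r : ℝ → Fin 3 → ℝ) (v : ℝ) : Fin 4 → ℝ := emb (deriv r v)

/-- The normal frame vector `n₁ = n`. -/
def mn1 (r : ℝ → Fin 3 → ℝ) (v : ℝ) : Fin 4 → ℝ := emb (sphN r v)

/-- The normal frame vector `n₂ = −g′ r + f′ e₄`. -/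
def mn2 (f g : ℝ → ℝ) (r : ℝ → Fin 3 → ℝ) (u v : ℝ) : Fin 4 → ℝ :=
  (-(deriv g u)) • emb (r v) + deriv f u • e4

/-- The Gauss map `G = x ∧ y` of the meridian surface, with values in `Λ²ℝ⁴`. -/
def gaussG (f g : ℝ → ℝ) (r : ℝ → Fin 3 → ℝ) (u v : ℝ) : Fin 4 → Fin 4 → ℝ :=
  wedge (mx f g r u v) (my r v)

/-- The Laplacian `Δφ = −(∂²φ/∂u² + (1/f²) ∂²φ/∂v² + (f′/f) ∂φ/∂u)` of the meridian
surface, acting on `Λ²ℝ⁴`-valued functions. -/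
def surfLap (f : ℝ → ℝ) (φ : ℝ → ℝ → Fin 4 → Fin 4 → ℝ) (u v : ℝ) : Fin 4 → Fin 4 → ℝ :=
  -(deriv (deriv (fun s => φ s v)) u + (1 / f u ^ 2) • deriv (deriv (fun s => φ u s)) v
    + (deriv f u / f u) • deriv (fun s => φ s v) u)

/-- `h(x,x)`: the normal component (w.r.t. `{n₁, n₂}`) of `∇′ₓx = ∂x/∂u`. -/
def hxx (f g : ℝ → ℝ) (r : ℝ → Fin 3 → ℝ) (u v : ℝ) : Fin 4 → ℝ :=
  (deriv (fun s => mx f g r s v) u ⬝ᵥ mn1 r v) • mn1 r v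
    + (deriv (fun s => mx f g r s v) u ⬝ᵥ mn2 f g r u v) • mn2 f g r u v

/-- `h(x,y)`: the normal component (w.r.t. `{n₁, n₂}`) of `∇′_y x = (1/f) ∂x/∂v`. -/
def hxy (f g : ℝ → ℝ) (r : ℝ → Fin 3 → ℝ) (u v : ℝ) : Fin 4 → ℝ :=
  (((1 / f u) • deriv (fun s => mx f g r u s) v) ⬝ᵥ mn1 r v) • mn1 r v
    + (((1 / f u) • deriv (fun s => mx f g r u s) v) ⬝ᵥ mn2 f g r u v) • mn2 f g r u v

/-- `h(y,y)`: the normal component (w.r.t. `{n₁, n₂}`) of `∇′_y y = (1/f) ∂y/∂v`. -/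
def hyy (f g : ℝ → ℝ) (r : ℝ → Fin 3 → ℝ) (u v : ℝ) : Fin 4 → ℝ :=
  (((1 / f u) • deriv (my r) v) ⬝ᵥ mn1 r v) • mn1 r v
    + (((1 / f u) • deriv (my r) v) ⬝ᵥ mn2 f g r u v) • mn2 f g r u v


theorem HasDerivAt.wedge_emb {p : ℝ → Fin 3 → ℝ} {p' : Fin 3 → ℝ} {v : ℝ}
    (c : Fin 4 → ℝ) (h : HasDerivAt p p' v) :
    HasDerivAt (fun s => wedge c (emb (p s))) (wedge c (emb p')) v := by
  have hp : ∀ k, HasDerivAt (fun s => p s k) (p' k) v := hasDerivAt_pi.1 h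
  have he : ∀ k, HasDerivAt (fun s => emb (p s) k) (emb p' k) v := by
    intro k
    fin_cases k
    · exact hp 0
    · exact hp 1
    · exact hp 2
    · exact hasDerivAt_const v (0 : ℝ)
  refine hasDerivAt_pi.2 fun i => hasDerivAt_pi.2 fun j => ?_
  exact ((he j).const_mul (c i)).sub ((he i).const_mul (c j))

theorem HasDerivAt.dotProduct_fin_three {p q : ℝ → Fin 3 → ℝ} {p' q' : Fin 3 → ℝ} {v : ℝ}
    (hp : HasDerivAt p p' v) (hq : HasDerivAt q q' v) :
    HasDerivAt (fun s => p s ⬝ᵥ q s) (p' ⬝ᵥ q v + p v ⬝ᵥ q') v := by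
  have hp' := hasDerivAt_pi.1 hp
  have hq' := hasDerivAt_pi.1 hq
  have h := (((hp' 0).mul (hq' 0)).add ((hp' 1).mul (hq' 1))).add ((hp' 2).mul (hq' 2))
  refine (h.congr_of_eventuallyEq (.of_forall fun s => ?_)).congr_deriv ?_
  · simp [dotProduct, Fin.sum_univ_three]
  · simp only [dotProduct, Fin.sum_univ_three]
    ring

theorem HasDerivAt.crossProduct {p q : ℝ → Fin 3 → ℝ} {p' q' : Fin 3 → ℝ} {v : ℝ}
    (hp : HasDerivAt p p' v) (hq : HasDerivAt q q' v) :
    HasDerivAt (fun s => crossProduct (p s) (q s))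
      (crossProduct p' (q v) + crossProduct (p v) q') v := by
  have hp' := hasDerivAt_pi.1 hp
  have hq' := hasDerivAt_pi.1 hq
  refine hasDerivAt_pi.2 fun k => ?_
  fin_cases k
  · convert ((hp' 1).mul (hq' 2)).sub ((hp' 2).mul (hq' 1)) using 1
    · ext s
      simp [cross_apply]
    · simp [cross_apply]
      ring
  · convert ((hp' 2).mul (hq' 0)).sub ((hp' 0).mul (hq' 2)) using 1
    · ext s
      simp [cross_apply]
    · simp [cross_apply]
      ring
  · convert ((hp' 0).mul (hq' 1)).sub ((hp' 1).mul (hq' 0)) using 1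
    · ext s
      simp [cross_apply]
    · simp [cross_apply]
      ring

/-- Expansion of a vector in the orthonormal basis `p, q, p × q`. -/
theorem eq_orthonormal_cross_expansion {p q w : Fin 3 → ℝ}
    (hp : p ⬝ᵥ p = 1) (hq : q ⬝ᵥ q = 1) (hpq : p ⬝ᵥ q = 0) :
    w = (w ⬝ᵥ p) • p + (w ⬝ᵥ q) • q + (w ⬝ᵥ crossProduct p q) • crossProduct p q := by
  have hqp : q ⬝ᵥ p = 0 := by rw [dotProduct_comm, hpq]
  have hM : Matrix.of ![p, q, crossProduct p q] * (Matrix.of ![p, q, crossProduct p q])ᵀ = 1 := by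
    ext i j
    change ![p, q, crossProduct p q] i ⬝ᵥ ![p, q, crossProduct p q] j = _
    fin_cases i <;> fin_cases j <;>
      simp [hp, hq, hpq, hqp, cross_dot_cross, dotProduct_comm (crossProduct p q)]
  have h := congrArg (fun N => N *ᵥ w) (mul_eq_one_comm.1 hM)
  simp only [one_mulVec, ← mulVec_mulVec] at h
  conv_lhs => rw [← h]
  ext i
  simp only [mulVec, dotProduct, Fin.sum_univ_three, transpose_apply, of_apply, cons_val_zero,
    cons_val_one, cons_val, Pi.add_apply, Pi.smul_apply, smul_eq_mul]
  ring

section SphericalCurve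

variable {J : Set ℝ} {r : ℝ → Fin 3 → ℝ} {v : ℝ}

/-- The Frenet equation `t' = κ n - r` of a unit speed spherical curve. -/
theorem deriv_deriv_eq_of_spherical (hJ : IsOpen J) (hr : ContDiffOn ℝ (⊤ : ℕ∞) r J)
    (hrs : ∀ v ∈ J, r v ⬝ᵥ r v = 1) (hra : ∀ v ∈ J, deriv r v ⬝ᵥ deriv r v = 1)
    (hv : v ∈ J) :
    deriv (deriv r) v = sphCurv r v • sphN r v - r v := by
  have hd : ∀ w ∈ J, HasDerivAt r (deriv r w) w := fun w hw =>
    ((hr.differentiableOn (by simp)).differentiableAt (hJ.mem_nhds hw)).hasDerivAt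
  have hd2 : HasDerivAt (deriv r) (deriv (deriv r) v) v :=
    (((hr.deriv_of_isOpen (m := (⊤ : ℕ∞)) hJ (by simp)).differentiableOn
      (by simp)).differentiableAt (hJ.mem_nhds hv)).hasDerivAt
  have hrt : ∀ w ∈ J, r w ⬝ᵥ deriv r w = 0 := by
    intro w hw
    have h := ((hd w hw).dotProduct_fin_three (hd w hw)).unique
      ((hasDerivAt_const w (1 : ℝ)).congr_of_eventuallyEq
        (Filter.eventuallyEq_of_mem (hJ.mem_nhds hw) hrs))
    rw [dotProduct_comm (deriv r w)] at h
    linarith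
  have htt : deriv (deriv r) v ⬝ᵥ deriv r v = 0 := by
    have h := (hd2.dotProduct_fin_three hd2).unique
      ((hasDerivAt_const v (1 : ℝ)).congr_of_eventuallyEq
        (Filter.eventuallyEq_of_mem (hJ.mem_nhds hv) hra))
    rw [dotProduct_comm (deriv r v)] at h
    linarith
  have htr : deriv (deriv r) v ⬝ᵥ r v = -1 := by
    have h := ((hd v hv).dotProduct_fin_three hd2).unique
      ((hasDerivAt_const v (0 : ℝ)).congr_of_eventuallyEq
        (Filter.eventuallyEq_of_mem (hJ.mem_nhds hv) hrt))
    rw [hra v hv, dotProduct_comm (r v)] at h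
    linarith
  have h := eq_orthonormal_cross_expansion (w := deriv (deriv r) v) (hrs v hv) (hra v hv)
    (hrt v hv)
  rw [htr, htt] at h
  rw [h, sphCurv, sphN]
  module

/-- For constant spherical curvature `κ₀`, the tangent satisfies `t'' = -(1 + κ₀²) t`. -/
theorem hasDerivAt_deriv_deriv_of_sphCurv_const (hJ : IsOpen J)
    (hr : ContDiffOn ℝ (⊤ : ℕ∞) r J)
    (hrs : ∀ v ∈ J, r v ⬝ᵥ r v = 1) (hra : ∀ v ∈ J, deriv r v ⬝ᵥ deriv r v = 1)
    {κ₀ : ℝ} (hκ : ∀ v ∈ J, sphCurv r v = κ₀) (hv : v ∈ J) :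
    HasDerivAt (deriv (deriv r)) (-(1 + κ₀ ^ 2) • deriv r v) v := by
  have hA : ∀ w ∈ J, deriv (deriv r) w = κ₀ • sphN r w - r w := fun w hw => by
    rw [deriv_deriv_eq_of_spherical hJ hr hrs hra hw, hκ w hw]
  have hd : HasDerivAt r (deriv r v) v :=
    ((hr.differentiableOn (by simp)).differentiableAt (hJ.mem_nhds hv)).hasDerivAt
  have hd2 : HasDerivAt (deriv r) (deriv (deriv r) v) v :=
    (((hr.deriv_of_isOpen (m := (⊤ : ℕ∞)) hJ (by simp)).differentiableOn
      (by simp)).differentiableAt (hJ.mem_nhds hv)).hasDerivAt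
  have hrt : r v ⬝ᵥ deriv r v = 0 := by
    have h := (hd.dotProduct_fin_three hd).unique
      ((hasDerivAt_const v (1 : ℝ)).congr_of_eventuallyEq
        (Filter.eventuallyEq_of_mem (hJ.mem_nhds hv) hrs))
    rw [dotProduct_comm (deriv r v)] at h
    linarith
  have h := (((hd.crossProduct hd2).const_smul κ₀).sub hd).congr_of_eventuallyEq
    (Filter.eventuallyEq_of_mem (hJ.mem_nhds hv) hA)
  have hrr := hrs v hv
  have hcc : crossProduct (r v) (crossProduct (r v) (deriv r v)) = -deriv r v := by
    rw [cross_cross_eq_smul_sub_smul', hrt, hrr]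
    module
  refine h.congr_deriv ?_
  rw [hA v hv, sphN, cross_self, map_sub, map_smul, hcc, cross_self]
  module

end SphericalCurve

/-- If `f ≡ a ≠ 0`, `g(u) = ±u + b` and `κ ≡ κ₀ ≠ 0`, then
`ΔG = ((1 + κ₀²)/a²) G`: `M²` has (non-proper) 1-type Gauss map of the first kind with
constant eigenvalue `λ = (1 + κ₀²)/a²`. -/
theorem meridian_surface_first_kind_example_f_const
    (I J : Set ℝ) (hI : IsOpen I) (hIiv : I.OrdConnected) (hIne : I.Nonempty)
    (hJ : IsOpen J) (hJiv : J.OrdConnected) (hJne : J.Nonempty)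
    (r : ℝ → Fin 3 → ℝ) (hr : ContDiffOn ℝ (⊤ : ℕ∞) r J)
    (hrs : ∀ v ∈ J, r v ⬝ᵥ r v = 1) (hra : ∀ v ∈ J, deriv r v ⬝ᵥ deriv r v = 1)
    (f g : ℝ → ℝ) (hf : ContDiffOn ℝ (⊤ : ℕ∞) f I) (hg : ContDiffOn ℝ (⊤ : ℕ∞) g I)
    (hf0 : ∀ u ∈ I, f u ≠ 0) (hfg : ∀ u ∈ I, deriv f u ^ 2 + deriv g u ^ 2 = 1)
    (a b κ₀ : ℝ) (ha : a ≠ 0) (hfa : ∀ u ∈ I, f u = a)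
    (hgb : (∀ u ∈ I, g u = u + b) ∨ ∀ u ∈ I, g u = -u + b)
    (hκ : ∀ v ∈ J, sphCurv r v = κ₀) (hκ0 : κ₀ ≠ 0) :
    ∀ u ∈ I, ∀ v ∈ J,
      surfLap f (gaussG f g r) u v = ((1 + κ₀ ^ 2) / a ^ 2) • gaussG f g r u v := by
  intro u hu v hv
  have hf' : ∀ s ∈ I, deriv f s = 0 := fun s hs => by
    rw [(Filter.eventuallyEq_of_mem (hI.mem_nhds hs) hfa).deriv_eq, deriv_const]
  obtain ⟨ε, hg'⟩ : ∃ ε : ℝ, ∀ s ∈ I, deriv g s = ε := by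
    rcases hgb with h | h
    · refine ⟨1, fun s hs => ?_⟩
      rw [(Filter.eventuallyEq_of_mem (hI.mem_nhds hs) h).deriv_eq]
      exact ((hasDerivAt_id s).add_const b).deriv
    · refine ⟨-1, fun s hs => ?_⟩
      rw [(Filter.eventuallyEq_of_mem (hI.mem_nhds hs) h).deriv_eq]
      exact ((hasDerivAt_id s).neg.add_const b).deriv
  have hG : ∀ s ∈ I, ∀ w, gaussG f g r s w = wedge (ε • e4) (emb (deriv r w)) := by
    intro s hs w
    simp [gaussG, mx, my, hf' s hs, hg' s hs]
  have hu1 : ∀ s ∈ I, deriv (fun s => gaussG f g r s v) s = 0 := fun s hs => by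
    rw [(Filter.eventuallyEq_of_mem (hI.mem_nhds hs) fun x hx => hG x hx v).deriv_eq,
      deriv_const]
  have hu2 : deriv (deriv fun s => gaussG f g r s v) u = 0 := by
    rw [(Filter.eventuallyEq_of_mem (hI.mem_nhds hu) hu1).deriv_eq, deriv_const]
  have hv1 : ∀ w ∈ J, deriv (fun s => gaussG f g r u s) w
      = wedge (ε • e4) (emb (deriv (deriv r) w)) := by
    intro w hw
    rw [funext (hG u hu)]
    exact (((hr.deriv_of_isOpen (m := (⊤ : ℕ∞)) hJ (by simp)).differentiableOn
      (by simp)).differentiableAt (hJ.mem_nhds hw)).hasDerivAt.wedge_emb _ |>.deriv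
  have hv2 : deriv (deriv fun s => gaussG f g r u s) v
      = wedge (ε • e4) (emb (-(1 + κ₀ ^ 2) • deriv r v)) := by
    rw [(Filter.eventuallyEq_of_mem (hJ.mem_nhds hv) hv1).deriv_eq]
    exact ((hasDerivAt_deriv_deriv_of_sphCurv_const hJ hr hrs hra hκ hv).wedge_emb _).deriv
  have hlin : ∀ (c : ℝ) (p : Fin 3 → ℝ),
      wedge (ε • e4) (emb (c • p)) = c • wedge (ε • e4) (emb p) := by
    intro c p
    have he : emb (c • p) = c • emb p := by
      ext k
      fin_cases k <;> simp [emb]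
    ext i j
    simp only [wedge, he, Pi.smul_apply, smul_eq_mul]
    ring
  rw [surfLap, hu2, hv2, hu1 u hu, hG u hu v, hfa u hu, hlin]
  module
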